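/- arXiv:2109.10129 — 7 statements merged into one kernel-verified Lean document; each statement's English description precedes it below -/
import Mathlib

section
/- Every logical node classifier expressible in graded modal logic GC₂ is captured by a simple and homogeneous AC-GNN: one in which every aggregation function is multiset sum, every combination function has the linear form comb(x, y) = f(xC + yA + b) for fixed matrices C, A ∈ ℝ^{k×k} and bias b ∈ ℝ^k with f the componentwise truncated ReLU f(z) = min(max(z, 0), 1), and the aggregation and combination functions are identical across all layers. -/
open FirstOrder

/-- The first-order vocabulary with one binary edge relation `E` and
`m` unary color predicates `c_i`. -/
def gnnLang (m : ℕ) : FirstOrder.Language where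
  Functions := fun _ => Empty
  Relations := fun n =>
    match n with
    | 1 => Fin m
    | 2 => Unit
    | _ => Empty

/-- The relational structure on the vertices of a vertex-colored graph:
`E` is interpreted as adjacency and the color predicate `c_i` holds of the
vertices colored `i`. -/
def graphStructure {m : ℕ} {V : Type} (G : SimpleGraph V) (c : V → Fin m) :
    (gnnLang m).Structure V where
  funMap := fun {n} f _ => f.elim
  RelMap := fun {n} r v =>
    match n, r, v with
    | 0, r, _ => r.elim
    | 1, i, v => c (v 0) = i
    | 2, _, v => G.Adj (v 0) (v 1)
    | (_ + 3), r, _ => r.elim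

/-- An aggregate-combine graph neural network: an embedding dimension `k`,
a number `L` of layers, aggregation functions (from finite multisets of
states to states), combination functions, and a Boolean classification
function.  (Aggregation/combination functions are indexed by the layer
number; only the first `L` of them are ever used.) -/
structure ACGNN where
  k : ℕ
  L : ℕ
  agg : ℕ → Multiset (Fin k → ℝ) → (Fin k → ℝ)
  comb : ℕ → (Fin k → ℝ) → (Fin k → ℝ) → (Fin k → ℝ)
  cls : (Fin k → ℝ) → Bool

/-- One-hot encoding of a color `i : Fin m` as a vector in `ℝ^k`. -/
def oneHot {m k : ℕ} (i : Fin m) : Fin k → ℝ :=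
  fun j => if (j : ℕ) = (i : ℕ) then 1 else 0

/-- The state `x_v^{(i)}` computed by an AC-GNN on a vertex-colored graph:
the initial state is the one-hot encoding of the color, and at each stage
every vertex aggregates the multiset of states of its neighbors and combines
the result with its own state. -/
def ACGNN.state (net : ACGNN) {m : ℕ} {V : Type} [Fintype V] [DecidableEq V]
    (G : SimpleGraph V) [DecidableRel G.Adj] (c : V → Fin m) :
    ℕ → V → (Fin net.k → ℝ)
  | 0 => fun v => oneHot (c v)
  | (i + 1) => fun v =>
      net.comb (i + 1) (net.state G c i v)
        (net.agg (i + 1) ((G.neighborFinset v).val.map (net.state G c i)))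

/-- The Boolean classification of a vertex computed by an AC-GNN. -/
def ACGNN.classify (net : ACGNN) {m : ℕ} {V : Type} [Fintype V] [DecidableEq V]
    (G : SimpleGraph V) [DecidableRel G.Adj] (c : V → Fin m) (v : V) : Bool :=
  net.cls (net.state G c net.L v)

/-- Syntax of graded modal logic `GC₂` (equivalently, the description logic
`ALCQ`): formulas in one free variable built from color predicates by Boolean
connectives and guarded counting quantifiers `∃^{≥n} y (E(x,y) ∧ φ(y))`. -/
inductive GC2 (m : ℕ) : Type
  | color : Fin m → GC2 m
  | not : GC2 m → GC2 m
  | and : GC2 m → GC2 m → GC2 m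
  | exGe : ℕ → GC2 m → GC2 m

/-- Semantics of `GC₂` on a vertex-colored graph: `exGe n φ` holds at `v` iff
`v` has at least `n` (distinct) neighbors satisfying `φ`. -/
def GC2.eval {m : ℕ} {V : Type} [Fintype V] (G : SimpleGraph V) (c : V → Fin m) :
    GC2 m → V → Prop
  | color i, v => c v = i
  | not φ, v => ¬ GC2.eval G c φ v
  | and φ ψ, v => GC2.eval G c φ v ∧ GC2.eval G c ψ v
  | exGe n φ, v => n ≤ {w | G.Adj v w ∧ GC2.eval G c φ w}.ncard

/-- The componentwise truncated ReLU `f(z) = min(max(z,0),1)`. -/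
noncomputable def truncReLU {k : ℕ} (z : Fin k → ℝ) : Fin k → ℝ :=
  fun j => min (max (z j) 0) 1

namespace GC2

def subs {m : ℕ} : GC2 m → List (GC2 m)
  | color i => [color i]
  | not φ => not φ :: subs φ
  | and φ χ => and φ χ :: (subs φ ++ subs χ)
  | exGe n φ => exGe n φ :: subs φ

def sz {m : ℕ} : GC2 m → ℕ
  | color _ => 1
  | not φ => sz φ + 1
  | and φ χ => sz φ + sz χ + 1
  | exGe _ φ => sz φ + 1

lemma self_mem_subs {m : ℕ} (φ : GC2 m) : φ ∈ subs φ := by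
  cases φ <;> simp [subs]

/-- immediate subformulas -/
def isub {m : ℕ} : GC2 m → List (GC2 m)
  | color _ => []
  | not φ => [φ]
  | and φ χ => [φ, χ]
  | exGe _ φ => [φ]

lemma subs_closed {m : ℕ} (ψ : GC2 m) :
    ∀ φ ∈ subs ψ, ∀ χ ∈ isub φ, χ ∈ subs ψ := by
  induction ψ with
  | color i => intro φ h χ hχ; simp [subs] at h; subst h; simp [isub] at hχ
  | not α ih =>
    intro φ h χ hχ
    simp only [subs, List.mem_cons] at h ⊢
    rcases h with rfl | h
    · simp only [isub, List.mem_singleton] at hχ; subst hχ; exact Or.inr (self_mem_subs _)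
    · exact Or.inr (ih φ h χ hχ)
  | exGe n α ih =>
    intro φ h χ hχ
    simp only [subs, List.mem_cons] at h ⊢
    rcases h with rfl | h
    · simp only [isub, List.mem_singleton] at hχ; subst hχ; exact Or.inr (self_mem_subs _)
    · exact Or.inr (ih φ h χ hχ)
  | and α β iha ihb =>
    intro φ h χ hχ
    simp only [subs, List.mem_cons, List.mem_append] at h ⊢
    rcases h with rfl | h | h
    · simp only [isub, List.mem_cons, List.not_mem_nil, or_false] at hχ
      rcases hχ with rfl | rfl
      · exact Or.inr (Or.inl (self_mem_subs _))
      · exact Or.inr (Or.inr (self_mem_subs _))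
    · exact Or.inr (Or.inl (iha φ h χ hχ))
    · exact Or.inr (Or.inr (ihb φ h χ hχ))

noncomputable def colC {m k : ℕ} (pos : GC2 m → Fin k) : GC2 m → Fin k → ℝ
  | color i => Pi.single (pos (color i)) 1
  | not φ => - Pi.single (pos φ) 1
  | and φ χ => Pi.single (pos φ) 1 + Pi.single (pos χ) 1
  | exGe _ _ => 0

noncomputable def colA {m k : ℕ} (pos : GC2 m → Fin k) : GC2 m → Fin k → ℝ
  | exGe _ φ => Pi.single (pos φ) 1
  | _ => 0

noncomputable def bias {m : ℕ} : GC2 m → ℝ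
  | color _ => 0
  | not _ => 1
  | and _ _ => -1
  | exGe n _ => 1 - n

open Classical in
noncomputable def ind (p : Prop) : ℝ := if p then 1 else 0

noncomputable def net {m k : ℕ} (pos : GC2 m → Fin k) (fs : Fin k → GC2 m) (L : ℕ)
    (cls : (Fin k → ℝ) → Bool) : ACGNN :=
  ACGNN.mk k L (fun _ S => S.sum)
    (fun _ x y => truncReLU (Matrix.vecMul x (Matrix.of fun a j => colC pos (fs j) a)
      + Matrix.vecMul y (Matrix.of fun a j => colA pos (fs j) a) + fun j => bias (fs j)))
    cls

noncomputable def st {m k : ℕ} (pos : GC2 m → Fin k) (fs : Fin k → GC2 m) (L : ℕ)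
    (cls : (Fin k → ℝ) → Bool) {V : Type} [Fintype V] [DecidableEq V]
    (G : SimpleGraph V) [DecidableRel G.Adj] (c : V → Fin m) (t : ℕ) (v : V) : Fin k → ℝ :=
  (net pos fs L cls).state G c t v

lemma net_step {m k : ℕ} (pos : GC2 m → Fin k) (fs : Fin k → GC2 m) (L : ℕ)
    (cls : (Fin k → ℝ) → Bool) {V : Type} [Fintype V] [DecidableEq V]
    (G : SimpleGraph V) [DecidableRel G.Adj] (c : V → Fin m) (t : ℕ) (v : V) (j : Fin k) :
    st pos fs L cls G c (t + 1) v j =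
      min (max (st pos fs L cls G c t v ⬝ᵥ colC pos (fs j)
        + (∑ w ∈ G.neighborFinset v, st pos fs L cls G c t w) ⬝ᵥ colA pos (fs j)
        + bias (fs j)) 0) 1 := by
  rfl

lemma correct {m k : ℕ} (pos : GC2 m → Fin k) (fs : Fin k → GC2 m) (L : ℕ)
    (cls : (Fin k → ℝ) → Bool) (hcol : ∀ i, ((pos (color i) : Fin k) : ℕ) = i)
    (hcf : ∀ i, fs (pos (color i)) = color i)
    (hcl : ∀ j, ∀ χ ∈ isub (fs j), fs (pos χ) = χ)
    {V : Type} [Fintype V] [DecidableEq V]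
    (G : SimpleGraph V) [DecidableRel G.Adj] (c : V → Fin m) (φ : GC2 m) :
    ∀ t, sz φ ≤ t → ∀ j, fs j = φ → ∀ v,
      st pos fs L cls G c t v j = ind (eval G c φ v) := by
  induction φ with
  | color i =>
    have key : ∀ t v, st pos fs L cls G c t v (pos (color i))
        = ind (c v = i) := by
      intro t
      induction t with
      | zero =>
        intro v
        change (if ((pos (color i) : Fin k) : ℕ) = (c v : ℕ) then (1 : ℝ) else 0) = _
        rw [hcol]
        unfold ind
        congr 1
        rw [eq_iff_iff, ← Fin.ext_iff, eq_comm]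
      | succ t ih =>
        intro v
        rw [net_step pos fs L cls G c t v _, hcf]
        simp only [colC, colA, bias, dotProduct_single, dotProduct_zero]
        rw [ih]
        unfold ind; split_ifs <;> simp
    intro t ht j hj v
    obtain ⟨t, rfl⟩ : ∃ s, t = s + 1 := ⟨t - 1, by simp [sz] at ht; omega⟩
    rw [net_step pos fs L cls G c t v _, hj]
    simp only [colC, colA, bias, dotProduct_single, dotProduct_zero, eval]
    rw [key]
    unfold ind; split_ifs <;> simp
  | not α ih =>
    intro t ht j hj v
    simp only [sz] at ht
    obtain ⟨t, rfl⟩ : ∃ s, t = s + 1 := ⟨t - 1, by omega⟩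
    have hα := hcl j α (by simp [hj, isub])
    rw [net_step pos fs L cls G c t v _, hj]
    simp only [colC, colA, bias, dotProduct_neg, dotProduct_single, dotProduct_zero, eval]
    rw [ih t (by omega) _ hα]
    by_cases h : eval G c α v <;> simp [ind, h]
  | and α β iha ihb =>
    intro t ht j hj v
    simp only [sz] at ht
    obtain ⟨t, rfl⟩ : ∃ s, t = s + 1 := ⟨t - 1, by omega⟩
    have hα := hcl j α (by simp [hj, isub])
    have hβ := hcl j β (by simp [hj, isub])
    rw [net_step pos fs L cls G c t v _, hj]
    simp only [colC, colA, bias, dotProduct_add, dotProduct_single, dotProduct_zero, eval]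
    rw [iha t (by omega) _ hα, ihb t (by omega) _ hβ]
    by_cases h : eval G c α v <;> by_cases h' : eval G c β v <;> simp [ind, h, h']
  | exGe n α ih =>
    intro t ht j hj v
    simp only [sz] at ht
    obtain ⟨t, rfl⟩ : ∃ s, t = s + 1 := ⟨t - 1, by omega⟩
    have hα := hcl j α (by simp [hj, isub])
    rw [net_step pos fs L cls G c t v _, hj]
    simp only [colC, colA, bias, dotProduct_single, dotProduct_zero, eval]
    rw [Finset.sum_apply, Finset.sum_congr rfl (fun w _ => ih t (by omega) _ hα w)]
    classical
    have hs : (∑ w ∈ G.neighborFinset v, ind (eval G c α w))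
        = (({w | G.Adj v w ∧ eval G c α w}.ncard : ℕ) : ℝ) := by
      have : {w | G.Adj v w ∧ eval G c α w}
          = (((G.neighborFinset v).filter fun w => eval G c α w : Finset V) : Set V) := by
        ext w; simp
      rw [this, Set.ncard_coe_finset, Finset.card_filter]
      push_cast
      apply Finset.sum_congr rfl
      intro w _
      unfold ind; split_ifs <;> rfl
    rw [hs]
    generalize {w | G.Adj v w ∧ eval G c α w}.ncard = N
    by_cases h : n ≤ N
    · have h2 : (n : ℝ) ≤ N := by exact_mod_cast h
      simp only [ind, h, if_true]
      rw [min_eq_right]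
      apply le_max_of_le_left; linarith
    · have h2 : (N : ℝ) + 1 ≤ n := by exact_mod_cast (by omega : N + 1 ≤ n)
      simp only [ind, h, if_false]
      rw [max_eq_right (by linarith)]
      simp

lemma exists_pos {m : ℕ} (ψ : GC2 m) : ∃ (k : ℕ) (fs : Fin k → GC2 m) (pos : GC2 m → Fin k),
    (∀ i, ((pos (color i) : Fin k) : ℕ) = i) ∧ (∀ i, fs (pos (color i)) = color i) ∧
    (∀ j, ∀ χ ∈ isub (fs j), fs (pos χ) = χ) ∧ fs (pos ψ) = ψ := by
  let l : List (GC2 m) := List.ofFn color ++ subs ψ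
  have hmem : ∀ φ, φ ∈ l ↔ (∃ i, color i = φ) ∨ φ ∈ subs ψ := by
    intro φ; simp [l, List.mem_ofFn]
  have hψ : ψ ∈ l := (hmem ψ).2 (Or.inr (self_mem_subs ψ))
  have hex : ∀ φ : GC2 m, ∃ p : Fin l.length, (φ ∈ l → l.get p = φ) ∧
      ∀ i, φ = color i → (p : ℕ) = i := by
    intro φ
    by_cases hc : ∃ i, φ = color i
    · obtain ⟨i, rfl⟩ := hc
      refine ⟨⟨i, by simp [l]; omega⟩, fun _ => ?_, fun i' h => ?_⟩
      · simp [l, List.getElem_append]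
      · cases h; rfl
    · by_cases hl : φ ∈ l
      · obtain ⟨p, hp⟩ := List.get_of_mem hl
        exact ⟨p, fun _ => hp, fun i h => absurd ⟨i, h⟩ hc⟩
      · obtain ⟨p, hp⟩ := List.get_of_mem hψ
        exact ⟨p, fun h => absurd h hl, fun i h => absurd ⟨i, h⟩ hc⟩
  choose pos h1 h2 using hex
  refine ⟨l.length, l.get, pos, fun i => h2 _ i rfl,
    fun i => h1 _ ((hmem _).2 (Or.inl ⟨i, rfl⟩)), fun j χ hχ => h1 _ ?_, h1 _ hψ⟩
  rcases (hmem _).1 (List.get_mem l j) with ⟨i, hi⟩ | h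
  · rw [← hi] at hχ; simp [isub] at hχ
  · exact (hmem _).2 (Or.inr (subs_closed ψ _ h χ hχ))

end GC2

/-- **Barceló et al.**: every logical node classifier expressible in graded
modal logic `GC₂` is captured by a *simple and homogeneous* AC-GNN: one whose
aggregation function is multiset sum in every layer, and whose combination
function is, in every layer, the same linear map followed by the truncated
ReLU, `comb(x, y) = f(xC + yA + b)`. -/
theorem gc2_captured_by_simple_homogeneous_acgnn (m : ℕ) (ψ : GC2 m) :
    ∃ (k L : ℕ) (C A : Matrix (Fin k) (Fin k) ℝ) (b : Fin k → ℝ)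
      (cls : (Fin k → ℝ) → Bool),
      ∀ (V : Type) [Fintype V] [DecidableEq V]
        (G : SimpleGraph V) [DecidableRel G.Adj] (c : V → Fin m) (v : V),
        (ACGNN.mk k L
          (fun _ S => S.sum)
          (fun _ x y => truncReLU (Matrix.vecMul x C + Matrix.vecMul y A + b))
          cls).classify G c v = true ↔ GC2.eval G c ψ v := by
  classical
  obtain ⟨k, fs, pos, h1, h2, h3, h4⟩ := GC2.exists_pos ψ
  refine ⟨k, GC2.sz ψ, Matrix.of fun a j => GC2.colC pos (fs j) a,
    Matrix.of fun a j => GC2.colA pos (fs j) a, fun j => GC2.bias (fs j),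
    fun x => decide (x (pos ψ) = 1), ?_⟩
  intro V _ _ G _ c v
  have h := GC2.correct pos fs (GC2.sz ψ) (fun x => decide (x (pos ψ) = 1)) h1 h2 h3 G c ψ
    (GC2.sz ψ) le_rfl (pos ψ) h4 v
  change decide (GC2.st pos fs (GC2.sz ψ) (fun x => decide (x (pos ψ) = 1)) G c
    (GC2.sz ψ) v (pos ψ) = 1) = true ↔ _
  rw [decide_eq_true_iff, h]
  unfold GC2.ind
  split_ifs with h <;> simp [h]
end

section
/- Every logical node classifier expressible in the two-variable counting logic C₂ is captured by a simple and homogeneous ACR-GNN, i.e., an ACR-GNN whose aggregation, readout, and combination functions are identical across all layers, with sum aggregation and readout and combination functions of the linear form comb(x, y, z) = f(xC + yA + zR + b) with fixed matrices C, A, R, bias b, and f the componentwise truncated ReLU. -/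
/-- An aggregate-combine-readout graph neural network (ACR-GNN): an embedding
dimension `k`, a number `L` of layers, aggregation and readout functions
(from finite multisets of states to states), combination functions taking the
previous state, the aggregated neighbor states and the readout over all
vertices, and a Boolean classification function.  (The layer-indexed functions
are indexed by `ℕ`; only the first `L` are ever used.) -/
structure ACRGNN where
  k : ℕ
  L : ℕ
  agg : ℕ → Multiset (Fin k → ℝ) → (Fin k → ℝ)
  read : ℕ → Multiset (Fin k → ℝ) → (Fin k → ℝ)
  comb : ℕ → (Fin k → ℝ) → (Fin k → ℝ) → (Fin k → ℝ) → (Fin k → ℝ)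
  cls : (Fin k → ℝ) → Bool

/-- The state `x_v^{(i)}` computed by an ACR-GNN on a vertex-colored graph:
the initial state is the one-hot encoding of the color; at each stage every
vertex combines its own state with the aggregation of the multiset of its
neighbors' states and the readout of the multiset of the states of *all*
vertices. -/
def ACRGNN.state (net : ACRGNN) {m : ℕ} {V : Type} [Fintype V] [DecidableEq V]
    (G : SimpleGraph V) [DecidableRel G.Adj] (c : V → Fin m) :
    ℕ → V → (Fin net.k → ℝ)
  | 0 => fun v => oneHot (c v)
  | (i + 1) => fun v =>
      net.comb (i + 1) (net.state G c i v)
        (net.agg (i + 1) ((G.neighborFinset v).val.map (net.state G c i)))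
        (net.read (i + 1) ((Finset.univ : Finset V).val.map (net.state G c i)))

/-- The Boolean classification of a vertex computed by an ACR-GNN. -/
def ACRGNN.classify (net : ACRGNN) {m : ℕ} {V : Type} [Fintype V] [DecidableEq V]
    (G : SimpleGraph V) [DecidableRel G.Adj] (c : V → Fin m) (v : V) : Bool :=
  net.cls (net.state G c net.L v)

/-- Syntax of the two-variable counting logic `C₂` over the edge/color
vocabulary (with equality): formulas use (at most) the two variables `0` and
`1` (of type `Fin 2`), atoms are color predicates, the edge relation and
equality between variables, and formulas are closed under Boolean connectives
and the counting quantifiers `∃^{≥n} t. φ` binding one of the two variables. -/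
inductive C2 (m : ℕ) : Type
  | color : Fin m → Fin 2 → C2 m
  | edge : Fin 2 → Fin 2 → C2 m
  | eq : Fin 2 → Fin 2 → C2 m
  | not : C2 m → C2 m
  | and : C2 m → C2 m → C2 m
  | exGe : ℕ → Fin 2 → C2 m → C2 m

/-- Semantics of `C₂` on a vertex-colored graph, relative to an assignment
`a : Fin 2 → V` of the two variables: `exGe n t φ` holds iff at least `n`
distinct vertices `w` satisfy `φ` when the variable `t` is reassigned to `w`. -/
def C2.eval {m : ℕ} {V : Type} [Fintype V] (G : SimpleGraph V) (c : V → Fin m) :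
    C2 m → (Fin 2 → V) → Prop
  | color i t, a => c (a t) = i
  | edge t u, a => G.Adj (a t) (a u)
  | eq t u, a => a t = a u
  | not φ, a => ¬ C2.eval G c φ a
  | and φ ψ, a => C2.eval G c φ a ∧ C2.eval G c ψ a
  | exGe n t φ, a => n ≤ {w | C2.eval G c φ (Function.update a t w)}.ncard

/-- Unary modal-style counting formulas. -/
inductive UF (m : ℕ) : Type
  | color : Fin m → UF m
  | tru : UF m
  | not : UF m → UF m
  | and : UF m → UF m → UF m
  | cnt : ℕ → UF m → UF m → UF m → UF m

def UF.sat {m : ℕ} {V : Type} (G : SimpleGraph V) (c : V → Fin m) : UF m → V → Prop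
  | color i, v => c v = i
  | tru, _ => True
  | not p, v => ¬ UF.sat G c p v
  | and p q, v => UF.sat G c p v ∧ UF.sat G c q v
  | cnt n p q r, v => n ≤ {w | (v = w ∧ UF.sat G c p w) ∨ (G.Adj v w ∧ UF.sat G c q w) ∨
      (v ≠ w ∧ ¬ G.Adj v w ∧ UF.sat G c r w)}.ncard

def UF.depth {m : ℕ} : UF m → ℕ
  | color _ => 1
  | tru => 1
  | not p => p.depth + 1
  | and p q => p.depth + q.depth + 1
  | cnt _ p q r => p.depth + q.depth + r.depth + 1

def UF.sub {m : ℕ} : UF m → List (UF m)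
  | color a => [color a]
  | tru => [tru]
  | not p => not p :: p.sub
  | and p q => and p q :: (p.sub ++ q.sub)
  | cnt n p q r => cnt n p q r :: (p.sub ++ q.sub ++ r.sub)

/-- immediate children -/
def UF.children {m : ℕ} : UF m → List (UF m)
  | color _ => []
  | tru => []
  | not p => [p]
  | and p q => [p, q]
  | cnt _ p q r => [p, q, r]

theorem UF.self_mem_sub {m : ℕ} (u : UF m) : u ∈ u.sub := by
  cases u <;> simp [UF.sub]

theorem UF.children_mem_sub {m : ℕ} (u : UF m) :
    ∀ p ∈ u.sub, ∀ q ∈ p.children, q ∈ u.sub := by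
  induction u with
  | color a => simp [UF.sub, UF.children]
  | tru => simp [UF.sub, UF.children]
  | not p ih =>
    intro x hx y hy
    simp only [UF.sub, List.mem_cons] at hx ⊢
    rcases hx with rfl | hx
    · simp only [UF.children, List.mem_singleton] at hy
      subst hy; exact Or.inr (UF.self_mem_sub _)
    · exact Or.inr (ih x hx y hy)
  | and p q ih1 ih2 =>
    intro x hx y hy
    simp only [UF.sub, List.mem_cons, List.mem_append] at hx ⊢
    rcases hx with rfl | hx | hx
    · simp only [UF.children, List.mem_cons, List.not_mem_nil, or_false] at hy
      rcases hy with rfl | rfl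
      · exact Or.inr (Or.inl (UF.self_mem_sub _))
      · exact Or.inr (Or.inr (UF.self_mem_sub _))
    · exact Or.inr (Or.inl (ih1 x hx y hy))
    · exact Or.inr (Or.inr (ih2 x hx y hy))
  | cnt n p q r ih1 ih2 ih3 =>
    intro x hx y hy
    simp only [UF.sub, List.mem_cons, List.mem_append] at hx ⊢
    rcases hx with rfl | (hx | hx) | hx
    · simp only [UF.children, List.mem_cons, List.not_mem_nil, or_false] at hy
      rcases hy with rfl | rfl | rfl
      · exact Or.inr (Or.inl (Or.inl (UF.self_mem_sub _)))
      · exact Or.inr (Or.inl (Or.inr (UF.self_mem_sub _)))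
      · exact Or.inr (Or.inr (UF.self_mem_sub _))
    · exact Or.inr (Or.inl (Or.inl (ih1 x hx y hy)))
    · exact Or.inr (Or.inl (Or.inr (ih2 x hx y hy)))
    · exact Or.inr (Or.inr (ih3 x hx y hy))

theorem UF.exists_bigOr {m : ℕ} {T : Type} [Fintype T] (τ : T → UF m) (S : T → Prop) :
    ∃ u : UF m, ∀ (V : Type) (G : SimpleGraph V) (c : V → Fin m) (v : V),
      u.sat G c v ↔ ∃ t, S t ∧ (τ t).sat G c v := by
  classical
  have key : ∀ s : Finset T, ∃ u : UF m, ∀ (V : Type) (G : SimpleGraph V) (c : V → Fin m) (v : V),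
      u.sat G c v ↔ ∃ t ∈ s, S t ∧ (τ t).sat G c v := by
    intro s
    induction s using Finset.induction_on with
    | empty => exact ⟨.not .tru, by simp [UF.sat]⟩
    | insert a s ha ih =>
      obtain ⟨u, hu⟩ := ih
      by_cases hS : S a
      · refine ⟨.not (.and (.not u) (.not (τ a))), fun V G c v => ?_⟩
        simp only [UF.sat, hu, Finset.exists_mem_insert, hS, true_and]
        by_cases h1 : (τ a).sat G c v <;>
          by_cases h2 : ∃ t ∈ s, S t ∧ (τ t).sat G c v <;> simp only [h1, h2] <;> decide
      · refine ⟨u, fun V G c v => ?_⟩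
        simp only [hu, Finset.exists_mem_insert, hS, false_and, false_or]
  obtain ⟨u, hu⟩ := key Finset.univ
  exact ⟨u, fun V G c v => by simp [hu]⟩

theorem UF.exists_count {m : ℕ} {T : Type} [Fintype T] (τ : T → UF m)
    (hτ : ∀ (V : Type) (G : SimpleGraph V) (c : V → Fin m) (v : V), ∃! t, (τ t).sat G c v)
    (F : T → T → Prop → Prop → Prop) (n : ℕ) :
    ∃ u : UF m, ∀ (V : Type) (G : SimpleGraph V) (c : V → Fin m) (v : V) (s : T),
      (τ s).sat G c v → (u.sat G c v ↔
        n ≤ {w | ∃ t, (τ t).sat G c w ∧ F s t (v = w) (G.Adj v w)}.ncard) := by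
  choose P hP using fun s => UF.exists_bigOr τ (fun t => F s t True False)
  choose Q hQ using fun s => UF.exists_bigOr τ (fun t => F s t False True)
  choose R hR using fun s => UF.exists_bigOr τ (fun t => F s t False False)
  obtain ⟨u, hu⟩ := UF.exists_bigOr (fun s => UF.and (τ s) (.cnt n (P s) (Q s) (R s)))
    (fun _ => True)
  refine ⟨u, fun V G c v s hs => ?_⟩
  rw [hu]
  have h1 : (∃ t, True ∧ ((τ t).and (.cnt n (P t) (Q t) (R t))).sat G c v) ↔
      (UF.cnt n (P s) (Q s) (R s)).sat G c v := by
    constructor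
    · rintro ⟨t, -, h1, h2⟩
      rwa [(hτ V G c v).unique hs h1]
    · intro h; exact ⟨s, trivial, hs, h⟩
  rw [h1, UF.sat]
  have : {w | (v = w ∧ UF.sat G c (P s) w) ∨ (G.Adj v w ∧ UF.sat G c (Q s) w) ∨
      (v ≠ w ∧ ¬ G.Adj v w ∧ UF.sat G c (R s) w)} =
      {w | ∃ t, (τ t).sat G c w ∧ F s t (v = w) (G.Adj v w)} := by
    ext w
    simp only [Set.mem_ofPred_eq, hP, hQ, hR]
    by_cases h : v = w
    · subst h; simp [and_comm]
    · by_cases h' : G.Adj v w <;> simp [h, h', and_comm]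
  rw [this]

theorem C2.nf {m : ℕ} (φ : C2 m) : ∃ (T : Type) (_ : Fintype T) (τ : T → UF m)
    (F : T → T → Prop → Prop → Prop),
    (∀ (V : Type) (G : SimpleGraph V) (c : V → Fin m) (v : V), ∃! t, (τ t).sat G c v) ∧
    ∀ (V : Type) [Fintype V] (G : SimpleGraph V) (c : V → Fin m) (a : Fin 2 → V) (s t : T),
      (τ s).sat G c (a 0) → (τ t).sat G c (a 1) →
      (C2.eval G c φ a ↔ F s t (a 0 = a 1) (G.Adj (a 0) (a 1))) := by
  induction φ with
  | color i t =>
    refine ⟨Fin m, inferInstance, UF.color, fun s s' _ _ => if t = 0 then s = i else s' = i, ?_, ?_⟩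
    · intro V G c v
      exact ⟨c v, rfl, fun y hy => Eq.symm hy⟩
    · intro V _ G c a s s' hs hs'
      simp only [UF.sat] at hs hs'
      fin_cases t <;> simp [C2.eval, hs, hs']
  | edge t u =>
    refine ⟨Unit, inferInstance, fun _ => .tru, fun _ _ _ r => if t = u then False else r, ?_, ?_⟩
    · intro V G c v
      exact ⟨(), trivial, fun y hy => rfl⟩
    · intro V _ G c a s s' hs hs'
      fin_cases t <;> fin_cases u <;> simp [C2.eval, G.adj_comm]
  | eq t u =>
    refine ⟨Unit, inferInstance, fun _ => .tru, fun _ _ r _ => if t = u then True else r, ?_, ?_⟩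
    · intro V G c v
      exact ⟨(), trivial, fun y hy => rfl⟩
    · intro V _ G c a s s' hs hs'
      fin_cases t <;> fin_cases u <;> simp [C2.eval, eq_comm]
  | not φ ih =>
    obtain ⟨T, i, τ, F, h1, h2⟩ := ih
    refine ⟨T, i, τ, fun s t p q => ¬ F s t p q, h1, ?_⟩
    intro V _ G c a s s' hs hs'
    rw [C2.eval, h2 V G c a s s' hs hs']
  | and φ ψ ih ih' =>
    obtain ⟨T, i, τ, F, h1, h2⟩ := ih
    obtain ⟨T', i', τ', F', h1', h2'⟩ := ih'
    refine ⟨T × T', inferInstance, fun x => .and (τ x.1) (τ' x.2),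
      fun s t p q => F s.1 t.1 p q ∧ F' s.2 t.2 p q, ?_, ?_⟩
    · intro V G c v
      obtain ⟨x, hx, hx'⟩ := h1 V G c v
      obtain ⟨y, hy, hy'⟩ := h1' V G c v
      refine ⟨(x, y), ⟨hx, hy⟩, ?_⟩
      rintro ⟨a, b⟩ ⟨ha, hb⟩
      exact Prod.ext (hx' _ ha) (hy' _ hb)
    · intro V _ G c a s s' hs hs'
      rw [C2.eval, h2 V G c a s.1 s'.1 hs.1 hs'.1, h2' V G c a s.2 s'.2 hs.2 hs'.2]
  | exGe n t φ ih =>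
    obtain ⟨T, i, τ, F, h1, h2⟩ := ih
    obtain ⟨u, hu⟩ := UF.exists_count τ h1 (fun s s' p q => if t = 1 then F s s' p q else F s' s p q) n
    refine ⟨Bool, inferInstance, fun b => if b then u else .not u,
      fun s s' _ _ => if t = 1 then s = true else s' = true, ?_, ?_⟩
    · intro V G c v
      by_cases h : u.sat G c v
      · refine ⟨true, by simpa using h, ?_⟩
        rintro (_|_) hy
        · exact absurd h (by simpa [UF.sat] using hy)
        · rfl
      · refine ⟨false, by simpa [UF.sat] using h, ?_⟩
        rintro (_|_) hy
        · rfl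
        · exact absurd (by simpa using hy) h
    · intro V _ G c a s s' hs hs'
      have hb : ∀ (b : Bool) (v : V), (if b then u else UF.not u).sat G c v →
          (b = true ↔ u.sat G c v) := by
        rintro (_|_) v hv
        · simpa [UF.sat] using hv
        · simpa using hv
      rw [C2.eval]
      fin_cases t
      · obtain ⟨x, hx, -⟩ := h1 V G c (a 1)
        simp only [Fin.zero_eta, Fin.isValue, zero_ne_one, if_false] at hu ⊢
        rw [hb _ _ hs', hu V G c _ x hx]
        have : {w | C2.eval G c φ (Function.update a 0 w)} =
            {w | ∃ t, (τ t).sat G c w ∧ F t x (a 1 = w) (G.Adj (a 1) w)} := by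
          ext w
          simp only [Set.mem_ofPred_eq]
          obtain ⟨y, hy, hy'⟩ := h1 V G c w
          rw [h2 V G c _ y x (by simpa using hy) (by simpa using hx)]
          simp only [Function.update_self, ne_eq, one_ne_zero, not_false_eq_true,
            Function.update_of_ne, eq_comm (a := w), G.adj_comm w]
          exact ⟨fun h => ⟨y, hy, h⟩, fun ⟨z, hz, h⟩ => by rwa [← hy' z hz]⟩
        rw [this]
      · obtain ⟨x, hx, -⟩ := h1 V G c (a 0)
        simp only [Fin.mk_one, Fin.isValue, if_true] at hu ⊢
        rw [hb _ _ hs, hu V G c _ x hx]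
        have : {w | C2.eval G c φ (Function.update a 1 w)} =
            {w | ∃ t, (τ t).sat G c w ∧ F x t (a 0 = w) (G.Adj (a 0) w)} := by
          ext w
          simp only [Set.mem_ofPred_eq]
          obtain ⟨y, hy, hy'⟩ := h1 V G c w
          rw [h2 V G c _ x y (by simpa using hx) (by simpa using hy)]
          simp only [Function.update_self, ne_eq, zero_ne_one, not_false_eq_true,
            Function.update_of_ne]
          exact ⟨fun h => ⟨y, hy, h⟩, fun ⟨z, hz, h⟩ => by rwa [← hy' z hz]⟩
        rw [this]

theorem C2.exists_UF {m : ℕ} (φ : C2 m) : ∃ u : UF m, ∀ (V : Type) [Fintype V]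
    (G : SimpleGraph V) (c : V → Fin m) (v : V),
    u.sat G c v ↔ C2.eval G c φ (fun _ => v) := by
  obtain ⟨T, i, τ, F, h1, h2⟩ := C2.nf φ
  obtain ⟨u, hu⟩ := UF.exists_bigOr τ (fun s => F s s True False)
  refine ⟨u, fun V _ G c v => ?_⟩
  obtain ⟨x, hx, hx'⟩ := h1 V G c v
  rw [hu, h2 V G c _ x x hx hx]
  simp only [SimpleGraph.irrefl]
  exact ⟨fun ⟨z, h, hz⟩ => by rwa [← hx' z hz], fun h => ⟨x, h, hx⟩⟩

noncomputable section

def UF.wC {m k : ℕ} (g : UF m → Fin k) : UF m → Fin k → ℝ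
  | color a => Pi.single (g (color a)) 1
  | tru => 0
  | not p => - Pi.single (g p) 1
  | and p q => Pi.single (g p) 1 + Pi.single (g q) 1
  | cnt _ p _ r => Pi.single (g p) 1 - Pi.single (g r) 1

def UF.wA {m k : ℕ} (g : UF m → Fin k) : UF m → Fin k → ℝ
  | cnt _ _ q r => Pi.single (g q) 1 - Pi.single (g r) 1
  | _ => 0

def UF.wR {m k : ℕ} (g : UF m → Fin k) : UF m → Fin k → ℝ
  | cnt _ _ _ r => Pi.single (g r) 1
  | _ => 0

def UF.wb {m : ℕ} : UF m → ℝ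
  | color _ => 0
  | tru => 1
  | not _ => 1
  | and _ _ => -1
  | cnt n _ _ _ => 1 - n

open Classical in
def UF.ind {m : ℕ} {V : Type} (G : SimpleGraph V) (c : V → Fin m) (u : UF m) (v : V) : ℝ :=
  if u.sat G c v then 1 else 0

end

theorem UF.cnt_card {m : ℕ} {V : Type} [Fintype V] [DecidableEq V]
    (G : SimpleGraph V) [DecidableRel G.Adj] (c : V → Fin m) (p q r : UF m) (v : V) :
    (({w | (v = w ∧ UF.sat G c p w) ∨ (G.Adj v w ∧ UF.sat G c q w) ∨
      (v ≠ w ∧ ¬ G.Adj v w ∧ UF.sat G c r w)}.ncard : ℕ) : ℝ) =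
    (p.ind G c v - r.ind G c v) +
      (∑ w ∈ G.neighborFinset v, q.ind G c w - ∑ w ∈ G.neighborFinset v, r.ind G c w) +
      ∑ w, r.ind G c w := by
  classical
  rw [Set.ncard_eq_toFinset_card', Set.toFinset_ofPred, Finset.card_filter]
  push_cast
  rw [← Finset.sum_sub_distrib]
  have e1 : p.ind G c v - r.ind G c v =
      ∑ w, if v = w then p.ind G c w - r.ind G c w else 0 := by simp
  have e2 : ∑ w ∈ G.neighborFinset v, (q.ind G c w - r.ind G c w) =
      ∑ w, if G.Adj v w then q.ind G c w - r.ind G c w else 0 := by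
    rw [SimpleGraph.neighborFinset_eq_filter, Finset.sum_filter]
  rw [e1, e2, ← Finset.sum_add_distrib, ← Finset.sum_add_distrib]
  refine Finset.sum_congr rfl fun w _ => ?_
  by_cases h : v = w
  · subst h; simp [UF.ind]
  · by_cases h' : G.Adj v w <;> simp [h, h', UF.ind]

theorem UF.net_correct {m k : ℕ} (f : Fin k → UF m) (g : UF m → Fin k)
    (hg : ∀ i, ∀ p ∈ (f i).children, f (g p) = p)
    (hgc : ∀ a, f (g (.color a)) = .color a)
    (hgv : ∀ a, ((g (.color a) : Fin k) : ℕ) = a)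
    (V : Type) [Fintype V] [DecidableEq V]
    (G : SimpleGraph V) [DecidableRel G.Adj] (c : V → Fin m)
    (Y : ℕ → V → Fin k → ℝ) (h0 : ∀ v, Y 0 v = oneHot (c v))
    (hstep : ∀ t v i, Y (t + 1) v i = min (max (Y t v ⬝ᵥ (f i).wC g +
            (∑ w ∈ G.neighborFinset v, Y t w) ⬝ᵥ (f i).wA g + (∑ w, Y t w) ⬝ᵥ (f i).wR g
            + (f i).wb) 0) 1) (t : ℕ) :
    (∀ a v, Y t v (g (.color a)) = (UF.color a).ind G c v) ∧
    ∀ i v, (f i).depth ≤ t → Y t v i = (f i).ind G c v := by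
  classical
  induction t with
  | zero =>
    refine ⟨fun a v => ?_, fun i v h => ?_⟩
    · simp only [h0, oneHot, hgv, UF.ind, UF.sat]
      simp only [Fin.ext_iff, eq_comm]
    · exfalso
      revert h
      cases f i <;> simp [UF.depth]
  | succ t ih =>
    obtain ⟨ih1, ih2⟩ := ih
    have step := hstep t
    set X : V → Fin k → ℝ := Y t with hX
    refine ⟨fun a v => ?_, fun i v h => ?_⟩
    · rw [step, hgc]
      simp only [UF.wC, UF.wA, UF.wR, UF.wb, dotProduct_single, dotProduct_zero, mul_one, add_zero]
      rw [ih1 a v]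
      unfold UF.ind; split_ifs <;> simp
    · have hc : ∀ p ∈ (f i).children, p.depth ≤ t → ∀ w, X w (g p) = p.ind G c w := by
        intro p hp hd w
        have := ih2 (g p) w (by rwa [hg i p hp])
        rwa [hg i p hp] at this
      rw [step]
      clear step
      generalize f i = u at h hc ⊢
      cases u with
      | color a =>
        simp only [UF.wC, UF.wA, UF.wR, UF.wb, dotProduct_single, dotProduct_zero, mul_one,
          add_zero]
        rw [ih1 a v]
        unfold UF.ind; split_ifs <;> simp
      | tru => simp [UF.wC, UF.wA, UF.wR, UF.wb, UF.ind, UF.sat]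
      | not p =>
        simp only [UF.depth] at h
        simp only [UF.wC, UF.wA, UF.wR, UF.wb, dotProduct_single, dotProduct_zero, mul_one,
          add_zero, dotProduct_neg]
        rw [hc p (by simp [UF.children]) (by omega)]
        by_cases hp : p.sat G c v <;> simp [UF.ind, UF.sat, hp]
      | and p q =>
        simp only [UF.depth] at h
        simp only [UF.wC, UF.wA, UF.wR, UF.wb, dotProduct_single, dotProduct_zero, mul_one,
          add_zero, dotProduct_add]
        rw [hc p (by simp [UF.children]) (by omega), hc q (by simp [UF.children]) (by omega)]
        by_cases hp : p.sat G c v <;> by_cases hq : q.sat G c v <;> simp [UF.ind, UF.sat, hp, hq]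
      | cnt n p q r =>
        simp only [UF.depth] at h
        simp only [UF.wC, UF.wA, UF.wR, UF.wb, dotProduct_single, mul_one,
          dotProduct_sub, Finset.sum_apply]
        have hp := hc p (by simp [UF.children]) (by omega)
        have hq := hc q (by simp [UF.children]) (by omega)
        have hr := hc r (by simp [UF.children]) (by omega)
        simp only [hp, hq, hr]
        rw [← UF.cnt_card G c p q r v]
        unfold UF.ind
        split_ifs with hN <;> rw [UF.sat] at hN
        · have h2 := Nat.cast_le (α := ℝ).mpr hN
          rw [max_eq_left (by linarith), min_eq_right (by linarith)]
        · have h2 := Nat.cast_le (α := ℝ).mpr (Nat.succ_le_of_lt (not_le.mp hN))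
          rw [Nat.cast_succ] at h2
          rw [max_eq_right (by linarith), min_eq_left (by linarith)]

/-- **Barceló et al.**: every logical node classifier expressible in the
two-variable counting logic `C₂` (a `C₂` formula with one free variable `x`,
i.e., whose truth value only depends on the value assigned to the variable
`0`) is captured by a *simple and homogeneous* ACR-GNN: aggregation and
readout are multiset sum in every layer, and the combination function is, in
every layer, the same linear map followed by the truncated ReLU,
`comb(x, y, z) = f(xC + yA + zR + b)`. -/
theorem c2_captured_by_simple_homogeneous_acrgnn (m : ℕ) (φ : C2 m)
    (hfree : ∀ (V : Type) [Fintype V] (G : SimpleGraph V) (c : V → Fin m)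
      (a a' : Fin 2 → V), a 0 = a' 0 → (C2.eval G c φ a ↔ C2.eval G c φ a')) :
    ∃ (k L : ℕ) (C A R : Matrix (Fin k) (Fin k) ℝ) (b : Fin k → ℝ)
      (cls : (Fin k → ℝ) → Bool),
      ∀ (V : Type) [Fintype V] [DecidableEq V]
        (G : SimpleGraph V) [DecidableRel G.Adj] (c : V → Fin m) (v : V),
        (ACRGNN.mk k L
          (fun _ S => S.sum)
          (fun _ S => S.sum)
          (fun _ x y z =>
            truncReLU (Matrix.vecMul x C + Matrix.vecMul y A + Matrix.vecMul z R + b))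
          cls).classify G c v = true ↔ C2.eval G c φ (fun _ => v) := by
  classical
  obtain ⟨u, hu⟩ := C2.exists_UF φ
  let f : Fin (m + u.sub.length) → UF m := Fin.append UF.color u.sub.get
  have hmem : ∀ p ∈ u.sub, ∃ i, f i = p := by
    intro p hp
    obtain ⟨j, hj⟩ := List.mem_iff_get.mp hp
    exact ⟨Fin.natAdd m j, by simp only [f, Fin.append_right]; exact hj⟩
  obtain ⟨i₀, hi₀⟩ := hmem u u.self_mem_sub
  have hex : ∀ p : UF m, ∃ i : Fin (m + u.sub.length),
      (p ∈ u.sub → f i = p) ∧ ∀ a, p = .color a → f i = p ∧ (i : ℕ) = a := by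
    intro p
    by_cases hc : ∃ a, p = .color a
    · obtain ⟨a, rfl⟩ := hc
      have h1 : f (Fin.castAdd _ a) = .color a := by simp only [f, Fin.append_left]
      refine ⟨Fin.castAdd _ a, fun _ => h1, ?_⟩
      intro b hb
      cases hb
      exact ⟨h1, rfl⟩
    · by_cases hp : p ∈ u.sub
      · obtain ⟨i, hi⟩ := hmem p hp
        exact ⟨i, fun _ => hi, fun a ha => absurd ⟨a, ha⟩ hc⟩
      · exact ⟨i₀, fun h => absurd h hp, fun a ha => absurd ⟨a, ha⟩ hc⟩
  choose g hg1 hg2 using hex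
  have hg : ∀ i, ∀ p ∈ (f i).children, f (g p) = p := by
    intro i
    refine Fin.addCases (fun a => ?_) (fun j => ?_) i
    · simp only [f, Fin.append_left, UF.children]
      simp
    · intro p hp
      refine hg1 p (u.children_mem_sub _ (List.get_mem u.sub j) p ?_)
      simpa only [f, Fin.append_right] using hp
  refine ⟨m + u.sub.length, u.depth, Matrix.of fun j i => (f i).wC g j,
    Matrix.of fun j i => (f i).wA g j, Matrix.of fun j i => (f i).wR g j,
    fun i => (f i).wb, fun x => decide (x i₀ = 1), ?_⟩
  intro V _ _ G _ c v
  rw [← hu]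
  have := (UF.net_correct f g hg
    (fun a => (hg2 _ a rfl).1) (fun a => (hg2 _ a rfl).2) V G c
    (ACRGNN.state (ACRGNN.mk (m + u.sub.length) u.depth (fun _ S => S.sum) (fun _ S => S.sum)
          (fun _ x y z =>
            truncReLU (Matrix.vecMul x (Matrix.of fun j i => (f i).wC g j) +
              Matrix.vecMul y (Matrix.of fun j i => (f i).wA g j) +
              Matrix.vecMul z (Matrix.of fun j i => (f i).wR g j) + fun i => (f i).wb))
          (fun x => decide (x i₀ = 1))) G c) (fun _ => rfl) (fun _ _ _ => rfl)
    u.depth).2 i₀ v (by rw [hi₀])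
  rw [ACRGNN.classify, decide_eq_true_iff]
  erw [this]
  rw [hi₀, UF.ind]
  split_ifs with h <;> simp [h]
end

section
/- The Weisfeiler-Lehman color refinement procedure bounds the distinguishing power of AC-GNNs: for every vertex-colored graph G, every pair of vertices v, w of G, and every AC-GNN with L layers, if the WL color refinement assigns the same color to v and w after L rounds (i.e., c^L(v) = c^L(w)), then the AC-GNN computes the same final state x_v^(L) = x_w^(L), and hence every AC-GNN classifier maps v and w into the same class. -/
/-- The type of Weisfeiler-Lehman colors after `i` rounds of refinement,
starting from `m` initial colors: a round-`(i+1)` color is a pair of a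
round-`i` color and a multiset of round-`i` colors. -/
def WLColor (m : ℕ) : ℕ → Type
  | 0 => Fin m
  | (i + 1) => WLColor m i × Multiset (WLColor m i)

/-- Weisfeiler-Lehman color refinement on a vertex-colored graph:
`c⁰(v)` is the initial color of `v`, and
`c^{i+1}(v) = (c^i(v), {{c^i(w) : w ∈ N_G(v)}})`. -/
def wl {m : ℕ} {V : Type} [Fintype V] [DecidableEq V]
    (G : SimpleGraph V) [DecidableRel G.Adj] (c : V → Fin m) :
    (i : ℕ) → V → WLColor m i
  | 0, v => c v
  | (i + 1), v => ((wl G c i v, (G.neighborFinset v).val.map (wl G c i)) : WLColor m (i + 1))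

/-- The state determined by a WL color. -/
def decodeWL (net : ACGNN) (m : ℕ) : (i : ℕ) → WLColor m i → (Fin net.k → ℝ)
  | 0 => fun a => oneHot (show Fin m from a)
  | (i + 1) => fun p =>
      net.comb (i + 1) (decodeWL net m i (show WLColor m i × Multiset (WLColor m i) from p).1)
        (net.agg (i + 1)
          ((show WLColor m i × Multiset (WLColor m i) from p).2.map (decodeWL net m i)))

theorem state_eq_decodeWL {m : ℕ} {V : Type} [Fintype V] [DecidableEq V]
    (G : SimpleGraph V) [DecidableRel G.Adj] (c : V → Fin m) (net : ACGNN) (i : ℕ) :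
    net.state G c i = fun v => decodeWL net m i (wl G c i v) := by
  induction i with
  | zero => rfl
  | succ i ih =>
    funext v
    change net.comb (i + 1) (net.state G c i v)
        (net.agg (i + 1) ((G.neighborFinset v).val.map (net.state G c i))) =
      net.comb (i + 1) (decodeWL net m i (wl G c i v))
        (net.agg (i + 1) (((G.neighborFinset v).val.map (wl G c i)).map (decodeWL net m i)))
    rw [ih, Multiset.map_map]
    rfl

/-- **WL bounds the distinguishing power of AC-GNNs**: for every vertex-colored
graph, every pair of vertices `v, w`, and every AC-GNN with `L` layers, if WL
color refinement assigns the same color to `v` and `w` after `L` rounds, then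
the AC-GNN computes the same final states `x_v^{(L)} = x_w^{(L)}`, and hence
classifies `v` and `w` into the same class. -/
theorem wl_refines_acgnn {m : ℕ} {V : Type} [Fintype V] [DecidableEq V]
    (G : SimpleGraph V) [DecidableRel G.Adj] (c : V → Fin m)
    (net : ACGNN) (v w : V)
    (h : wl G c net.L v = wl G c net.L w) :
    net.state G c net.L v = net.state G c net.L w ∧
      net.classify G c v = net.classify G c w := by
  have hs : net.state G c net.L v = net.state G c net.L w := by
    simp only [state_eq_decodeWL, h]
  exact ⟨hs, by simp only [ACGNN.classify, hs]⟩
end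

section
/- In the Blocksworld domain with goal Clear(x) for a fixed block x, the optimal value function satisfies, for every well-formed state s: V*(s) = H·[the goal Clear(x) is not satisfied in s and the gripper holds a block] + (2n − 1)·[n ≥ 1], where n is the number of blocks above x in s (the number of blocks b with b above x under the transitive closure of the on-relation), [·] is 1 if the condition holds and 0 otherwise, and H·[…] contributes 1 when its condition holds. In particular, V*(s) = 2n − 1 if n ≥ 1 and the gripper is empty, V*(s) = 2n if n ≥ 1 and the gripper holds a block, V*(s) = 1 if n = 0 and the gripper holds x, and V*(s) = 0 if x is clear. -/
open scoped Classical

/-- A (raw) Blocksworld state over a set `B` of blocks: `onb b = some b'` says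
that `b` sits directly on `b'` (`onb b = none`: `b` is on the table or held),
and `hold` is the content of the gripper. -/
structure BW (B : Type*) where
  onb : B → Option B
  hold : Option B

/-- `Above s a b`: block `a` is (somewhere) above block `b`, i.e., the
transitive closure of the on-relation. -/
def Above {B : Type*} (s : BW B) : B → B → Prop :=
  Relation.TransGen (fun u v => s.onb u = some v)

/-- A block is clear if no block is on it and it is not held. -/
def ClearB {B : Type*} (s : BW B) (b : B) : Prop :=
  (∀ b', s.onb b' ≠ some b) ∧ s.hold ≠ some b

/-- Well-formedness of a Blocksworld state: the held block (if any) is not on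
any block and no block is on it, no two distinct blocks are on the same block,
and the `Above` relation is irreflexive. -/
def WFBW {B : Type*} (s : BW B) : Prop :=
  (∀ b, s.hold = some b → s.onb b = none) ∧
  (∀ b b', s.hold = some b → s.onb b' ≠ some b) ∧
  (∀ b₁ b₂ b, s.onb b₁ = some b → s.onb b₂ = some b → b₁ = b₂) ∧
  (∀ b, ¬ Above s b b)

/-- The Blocksworld actions: pick up a clear block when the gripper is empty
(removing its on-fact, if any), put the held block down onto the table, or put
the held block down onto a clear block. -/
inductive BWStep {B : Type*} [DecidableEq B] : BW B → BW B → Prop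
  | pickup (s : BW B) (b : B) (h1 : s.hold = none) (h2 : ClearB s b) :
      BWStep s ⟨fun b' => if b' = b then none else s.onb b', some b⟩
  | putTable (s : BW B) (b : B) (h : s.hold = some b) :
      BWStep s ⟨s.onb, none⟩
  | putOn (s : BW B) (b c : B) (h : s.hold = some b)
      (hc : ∀ b', s.onb b' ≠ some c) (hbc : b ≠ c) :
      BWStep s ⟨Function.update s.onb b (some c), none⟩

/-- The set of lengths of plans from state `s` to the goal condition `Goal`:
`n` belongs to it iff some sequence of `n` actions transforms `s` into a state
satisfying `Goal`.  The optimal value `V*(s)` is the least element of this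
set. -/
def BWPlanLengths {B : Type*} [DecidableEq B] (s : BW B) (Goal : BW B → Prop) :
    Set ℕ :=
  {n | ∃ τ : ℕ → BW B, τ 0 = s ∧ (∀ i < n, BWStep (τ i) (τ (i + 1))) ∧ Goal (τ n)}

noncomputable def bwVal {B : Type*} (x : B) (s : BW B) : ℕ :=
  (if ¬ ClearB s x ∧ s.hold ≠ none then 1 else 0) +
        (if 1 ≤ {b | Above s b x}.ncard then 2 * {b | Above s b x}.ncard - 1 else 0)

theorem bw_above_on {B : Type*} {x : B} {s : BW B} {a : B} (h : Above s a x) :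
    ∃ b, s.onb b = some x := by
  obtain ⟨b, _, hb⟩ := Relation.TransGen.tail'_iff.1 h
  exact ⟨b, hb⟩

theorem bw_clear_ncard {B : Type*} {x : B} {s : BW B} (h : ClearB s x) :
    {b | Above s b x}.ncard = 0 := by
  have : {b | Above s b x} = ∅ := by
    ext a
    simp only [Set.mem_setOf_eq, Set.mem_empty_iff_false, iff_false]
    intro ha
    obtain ⟨b, hb⟩ := bw_above_on ha
    exact h.1 b hb
  rw [this]; simp

theorem bw_clear_val {B : Type*} {x : B} {s : BW B} (h : ClearB s x) : bwVal x s = 0 := by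
  simp [bwVal, h, bw_clear_ncard h]

theorem bw_pick_above {B : Type*} [DecidableEq B] {x b : B} {s : BW B} (h2 : ClearB s b)
    {a : B} (ha : Above s a x) (hab : a ≠ b) :
    Above ⟨fun b' => if b' = b then none else s.onb b', some b⟩ a x := by
  induction ha using Relation.TransGen.head_induction_on with
  | single h => exact Relation.TransGen.single (by simpa [hab] using h)
  | @head a c h _ ih =>
    have hc : c ≠ b := by
      rintro rfl
      exact h2.1 _ h
    exact Relation.TransGen.head (by simpa [hab] using h) (ih hc)

theorem bw_step_le {B : Type*} [Fintype B] [DecidableEq B] {x : B} {s t : BW B}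
    (hs : ∀ b, s.hold = some b → s.onb b = none) (h : BWStep s t) :
    bwVal x s ≤ bwVal x t + 1 ∧ (∀ b, t.hold = some b → t.onb b = none) := by
  cases h with
  | pickup b h1 h2 =>
    refine ⟨?_, by simp⟩
    have key : {a | Above s a x}.ncard ≤
        {a | Above (⟨fun b' => if b' = b then none else s.onb b', some b⟩ : BW B) a x}.ncard + 1 := by
      refine le_trans (Set.ncard_le_ncard ?_ (Set.toFinite _)) (Set.ncard_insert_le b _)
      intro a ha
      by_cases hab : a = b
      · exact Or.inl hab
      · exact Or.inr (bw_pick_above h2 ha hab)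
    by_cases hc : ClearB (⟨fun b' => if b' = b then none else s.onb b', some b⟩ : BW B) x
    · have := bw_clear_ncard hc
      unfold bwVal
      simp only [h1]
      simp
      split_ifs <;> omega
    · unfold bwVal
      simp only [h1, hc]
      simp
      split_ifs <;> omega
  | putTable b h =>
    refine ⟨?_, by simp⟩
    have key : {a | Above (⟨s.onb, none⟩ : BW B) a x} = {a | Above s a x} := rfl
    unfold bwVal
    rw [key]
    simp only [ne_eq, not_true_eq_false, and_false, if_false]
    split_ifs <;> omega
  | putOn b c h hc hbc =>
    refine ⟨?_, by simp⟩
    have key : {a | Above s a x}.ncard ≤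
        {a | Above (⟨Function.update s.onb b (some c), none⟩ : BW B) a x}.ncard := by
      refine Set.ncard_le_ncard ?_ (Set.toFinite _)
      intro a ha
      refine Relation.TransGen.mono ?_ _ _ ha
      intro u v huv
      have : u ≠ b := by
        rintro rfl
        rw [hs _ h] at huv
        cases huv
      simpa [Function.update_of_ne this] using huv
    unfold bwVal
    simp only [ne_eq, not_true_eq_false, and_false, if_false]
    split_ifs <;> omega

theorem bw_lower {B : Type*} [Fintype B] [DecidableEq B] {x : B} (n : ℕ) :
    ∀ s : BW B, (∀ b, s.hold = some b → s.onb b = none) →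
      n ∈ BWPlanLengths s (fun t => ClearB t x) → bwVal x s ≤ n := by
  induction n with
  | zero =>
    rintro s - ⟨τ, rfl, -, h⟩
    exact (bw_clear_val h).le
  | succ n ih =>
    rintro s hs ⟨τ, rfl, h1, h2⟩
    obtain ⟨h3, h4⟩ := bw_step_le (x := x) hs (h1 0 (by omega))
    have := ih (τ 1) h4 ⟨fun i => τ (i + 1), rfl, fun i hi => h1 (i + 1) (by omega), h2⟩
    simp only [zero_add] at h3
    omega

theorem bw_progress {B : Type*} [Fintype B] [DecidableEq B] {x : B} {s : BW B}
    (hs : ∀ b, ¬ Above s b b) (hx : ¬ ClearB s x) :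
    ∃ t, BWStep s t ∧ (∀ b, ¬ Above t b b) ∧ bwVal x t + 1 ≤ bwVal x s := by
  rcases hh : s.hold with _ | c
  · have hne : ∃ a, Above s a x := by
      by_contra hcon
      push Not at hcon
      exact hx ⟨fun b hb => hcon b (Relation.TransGen.single hb), by simp [hh]⟩
    have wf : WellFounded (Above s) := by
      haveI : IsTrans B (Above s) := ⟨fun a b c h1 h2 => Relation.TransGen.trans h1 h2⟩
      haveI : Std.Irrefl (Above s) := ⟨hs⟩
      exact Finite.wellFounded_of_trans_of_irrefl _
    obtain ⟨b, hb, hmin⟩ := wf.has_min {a | Above s a x} hne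
    have hcl : ClearB s b := by
      refine ⟨fun b' h' => ?_, by simp [hh]⟩
      have h1 : Above s b' b := Relation.TransGen.single h'
      exact hmin b' (Relation.TransGen.trans h1 hb) h1
    refine ⟨_, BWStep.pickup s b hh hcl, ?_, ?_⟩
    · intro a ha
      refine hs a (Relation.TransGen.mono ?_ _ _ ha)
      intro u v huv
      by_cases hu : u = b
      · simp [hu] at huv
      · simpa [hu] using huv
    · have key : {a | Above (⟨fun b' => if b' = b then none else s.onb b', some b⟩ : BW B) a x}.ncard
          < {a | Above s a x}.ncard := by
        refine Set.ncard_lt_ncard ?_ (Set.toFinite _)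
        refine Set.ssubset_iff_of_subset ?_ |>.2 ⟨b, hb, ?_⟩
        · intro a ha
          refine Relation.TransGen.mono ?_ _ _ ha
          intro u v huv
          by_cases hu : u = b
          · simp [hu] at huv
          · simpa [hu] using huv
        · intro hb'
          obtain ⟨c, hc, -⟩ := Relation.TransGen.head'_iff.1 hb'
          simp at hc
      have hbx : b ≠ x := by
        rintro rfl
        exact hs _ hb
      by_cases hc : ClearB (⟨fun b' => if b' = b then none else s.onb b', some b⟩ : BW B) x
      · rw [bw_clear_val hc]
        unfold bwVal
        split_ifs <;> omega
      · have : 1 ≤ {a | Above (⟨fun b' => if b' = b then none else s.onb b', some b⟩ : BW B) a x}.ncard := by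
          rw [Nat.one_le_iff_ne_zero]
          intro h0
          rw [Set.ncard_eq_zero (Set.toFinite _)] at h0
          apply hc
          refine ⟨fun d hd => ?_, by simpa using hbx⟩
          have : d ∈ {a | Above (⟨fun b' => if b' = b then none else s.onb b', some b⟩ : BW B) a x} :=
            Relation.TransGen.single hd
          rw [h0] at this
          exact this
        unfold bwVal
        split_ifs <;> omega
  · refine ⟨_, BWStep.putTable s c hh, hs, ?_⟩
    have key : {a | Above (⟨s.onb, none⟩ : BW B) a x} = {a | Above s a x} := rfl
    unfold bwVal
    rw [key]
    simp [hx, hh]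

theorem bw_upper {B : Type*} [Fintype B] [DecidableEq B] {x : B} (n : ℕ) :
    ∀ s : BW B, (∀ b, ¬ Above s b b) → bwVal x s ≤ n →
      ∃ m ≤ bwVal x s, m ∈ BWPlanLengths s (fun t => ClearB t x) := by
  induction n with
  | zero =>
    intro s hs hn
    by_cases hx : ClearB s x
    · exact ⟨0, Nat.zero_le _, fun _ => s, rfl, by simp, hx⟩
    · obtain ⟨t, -, -, h⟩ := bw_progress hs hx
      omega
  | succ n ih =>
    intro s hs hn
    by_cases hx : ClearB s x
    · exact ⟨0, Nat.zero_le _, fun _ => s, rfl, by simp, hx⟩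
    · obtain ⟨t, h1, h2, h3⟩ := bw_progress hs hx
      obtain ⟨m, hm, τ, h0, hstep, hg⟩ := ih t h2 (by omega)
      refine ⟨m + 1, by omega, fun i => Nat.casesOn i s τ, rfl, ?_, hg⟩
      intro i hi
      cases i with
      | zero => simpa [h0] using h1
      | succ i => exact hstep i (by omega)

/-- **Optimal value function for Blocksworld-Clear**: for the goal `Clear(x)`
and every well-formed state `s`, with `n` the number of blocks above `x`,
`V*(s) = [goal unsatisfied ∧ gripper holds a block] + (2n − 1)·[n ≥ 1]`. -/
theorem blocksworld_clear_optimal_value {B : Type*} [Fintype B] [DecidableEq B]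
    (x : B) (s : BW B) (hwf : WFBW s) :
    IsLeast (BWPlanLengths s (fun t => ClearB t x))
      ((if ¬ ClearB s x ∧ s.hold ≠ none then 1 else 0) +
        (if 1 ≤ {b | Above s b x}.ncard then 2 * {b | Above s b x}.ncard - 1 else 0)) := by
  change IsLeast _ (bwVal x s)
  obtain ⟨m, hm, hmem⟩ := bw_upper (x := x) _ s hwf.2.2.2 le_rfl
  have h := bw_lower m s hwf.1 hmem
  have : m = bwVal x s := le_antisymm hm h
  subst this
  exact ⟨hmem, fun k hk => bw_lower k s hwf.1 hk⟩
end

section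
/- In the two-room Gripper domain with goal At(x,y) for a fixed ball x and room y, the optimal value function satisfies, for every state s: V*(s) = 0 if x is located in room y; V*(s) = 1 + [the robot is not in room y] if x is held in a gripper; and V*(s) = 3 + [the robot is not in room r] + [both grippers are occupied] if x is located in a room r with r ≠ y, where [·] is 1 if the condition holds and 0 otherwise. -/
open scoped Classical

/-- A state of the two-room Gripper domain: the rooms are `false` and `true`,
the robot is in room `robot`, each ball is either located in a room
(`ballAt b = some r`) or held (`ballAt b = none`), and each of the two
grippers holds at most one ball (`grip g` is its content). -/
structure GripState (Ball : Type*) where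
  robot : Bool
  ballAt : Ball → Option Bool
  grip : Fin 2 → Option Ball

/-- Well-formedness: a ball is in no room iff it is held in some gripper, and
no ball is held in two grippers. -/
def WFGrip {Ball : Type*} (s : GripState Ball) : Prop :=
  (∀ b, s.ballAt b = none ↔ ∃ g, s.grip g = some b) ∧
  (∀ g g' b, s.grip g = some b → s.grip g' = some b → g = g')

/-- The Gripper actions: move (the robot changes to the other room), pick up a
ball located in the robot's current room with a free gripper, and drop a held
ball into the robot's current room. -/
inductive GripStep {Ball : Type*} [DecidableEq Ball] :
    GripState Ball → GripState Ball → Prop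
  | move (s : GripState Ball) :
      GripStep s ⟨!s.robot, s.ballAt, s.grip⟩
  | pick (s : GripState Ball) (b : Ball) (g : Fin 2)
      (h1 : s.ballAt b = some s.robot) (h2 : s.grip g = none) :
      GripStep s ⟨s.robot, Function.update s.ballAt b none,
        Function.update s.grip g (some b)⟩
  | drop (s : GripState Ball) (b : Ball) (g : Fin 2) (h : s.grip g = some b) :
      GripStep s ⟨s.robot, Function.update s.ballAt b (some s.robot),
        Function.update s.grip g none⟩

/-- The set of lengths of plans from state `s` to the goal condition `Goal`;
the optimal value `V*(s)` is its least element. -/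
def GripPlanLengths {Ball : Type*} [DecidableEq Ball] (s : GripState Ball)
    (Goal : GripState Ball → Prop) : Set ℕ :=
  {n | ∃ τ : ℕ → GripState Ball,
    τ 0 = s ∧ (∀ i < n, GripStep (τ i) (τ (i + 1))) ∧ Goal (τ n)}

theorem grip_cons {Ball : Type*} [DecidableEq Ball] {s t : GripState Ball}
    {G : GripState Ball → Prop} {n : ℕ} (h : GripStep s t) (hn : n ∈ GripPlanLengths t G) :
    n + 1 ∈ GripPlanLengths s G := by
  obtain ⟨τ, h0, h1, h2⟩ := hn
  refine ⟨fun i => Nat.casesOn i s τ, rfl, ?_, h2⟩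
  intro i hi
  cases i with
  | zero => simpa [h0] using h
  | succ k => exact h1 k (by omega)

theorem grip_zero {Ball : Type*} [DecidableEq Ball] {s : GripState Ball}
    {G : GripState Ball → Prop} (h : G s) : 0 ∈ GripPlanLengths s G :=
  ⟨fun _ => s, rfl, by simp, h⟩

noncomputable def gripV {Ball : Type*} (x : Ball) (y : Bool) (s : GripState Ball) : ℕ :=
  if s.ballAt x = some y then 0
       else if s.ballAt x = none then
         1 + (if s.robot ≠ y then 1 else 0)
       else
         3 + (if some s.robot ≠ s.ballAt x then 1 else 0) +
           (if ∀ g, s.grip g ≠ none then 1 else 0)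

def gripInv {Ball : Type*} (x : Ball) (s : GripState Ball) : Prop :=
  (∀ g, s.grip g = some x → s.ballAt x = none) ∧
  (∀ g g', s.grip g = some x → s.grip g' = some x → g = g')

theorem gripInv_step {Ball : Type*} [DecidableEq Ball] {x : Ball} {s t : GripState Ball}
    (h : GripStep s t) (hs : gripInv x s) : gripInv x t := by
  obtain ⟨h1, h2⟩ := hs
  cases h with
  | move => exact ⟨h1, h2⟩
  | pick b g hb hg =>
    constructor <;> simp only [Function.update_apply] <;> grind
  | drop b g hb =>
    constructor <;> simp only [Function.update_apply] <;> grind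

theorem gripV_step {Ball : Type*} [DecidableEq Ball] {x : Ball} {y : Bool} {s t : GripState Ball}
    (h : GripStep s t) (hs : gripInv x s) : gripV x y s ≤ gripV x y t + 1 := by
  obtain ⟨h1, h2⟩ := hs
  cases h with
  | move =>
    unfold gripV
    dsimp only
    split_ifs <;> first | omega | (exfalso; simp_all)
  | pick b g hb hg =>
    unfold gripV
    by_cases hx : x = b
    · subst hx
      have : ¬ ∀ g, s.grip g ≠ none := fun h => h g hg
      simp only [Function.update_self, hb, if_neg this]
      simp
      split_ifs <;> simp_all
    · have : ¬ ∀ g, s.grip g ≠ none := fun h => h g hg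
      simp only [Function.update_of_ne hx, if_neg this]
      split_ifs <;> omega
  | drop b g hb =>
    unfold gripV
    by_cases hx : x = b
    · subst hx
      have := h1 g hb
      simp only [Function.update_self, this]
      simp
      split_ifs <;> simp_all
    · simp only [Function.update_of_ne hx]
      split_ifs <;> omega

theorem gripV_lower {Ball : Type*} [DecidableEq Ball] {x : Ball} {y : Bool} (n : ℕ) :
    ∀ (s : GripState Ball), gripInv x s →
    n ∈ GripPlanLengths s (fun t => t.ballAt x = some y) → gripV x y s ≤ n := by
  induction n with
  | zero =>
    rintro s - ⟨τ, rfl, -, h⟩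
    simp [gripV, h]
  | succ n ih =>
    rintro s hs ⟨τ, rfl, h1, h2⟩
    have hst := h1 0 (by omega)
    have := ih (τ 1) (gripInv_step hst hs)
      ⟨fun i => τ (i + 1), rfl, fun i hi => h1 (i + 1) (by omega), h2⟩
    have := gripV_step (y := y) hst hs
    simp only [zero_add] at this
    omega

theorem grip_progress {Ball : Type*} [DecidableEq Ball] {x : Ball} {y : Bool} {s : GripState Ball}
    (hw : s.ballAt x = none → ∃ g, s.grip g = some x) (hs : gripInv x s)
    (hV : gripV x y s ≠ 0) :
    ∃ t, GripStep s t ∧ (t.ballAt x = none → ∃ g, t.grip g = some x) ∧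
      gripV x y t + 1 = gripV x y s := by
  have hy : s.ballAt x ≠ some y := by
    intro h; simp [gripV, h] at hV
  by_cases hn : s.ballAt x = none
  · obtain ⟨g, hg⟩ := hw hn
    by_cases hr : s.robot = y
    · exact ⟨_, .drop s x g hg, by simp, by simp [gripV, hn, hr]⟩
    · have : (!s.robot) = y := by revert hr; cases s.robot <;> cases y <;> simp
      exact ⟨_, .move s, fun _ => ⟨g, hg⟩, by simp [gripV, hn, hr, this]⟩
  · obtain ⟨r, hr⟩ := Option.ne_none_iff_exists'.1 hn
    have hry : r ≠ y := by rintro rfl; exact hy hr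
    by_cases hf : ∀ g, s.grip g ≠ none
    · obtain ⟨b, hb⟩ := Option.ne_none_iff_exists'.1 (hf 0)
      have hbx : x ≠ b := by rintro rfl; exact hn (hs.1 _ hb)
      refine ⟨_, .drop s b 0 hb, by simp [Function.update_of_ne hbx, hr], ?_⟩
      have : ¬ ∀ g, Function.update s.grip 0 none g ≠ none := fun h => h 0 (by simp)
      simp only [gripV, Function.update_of_ne hbx, hr, if_neg this, if_pos hf]
      simp [hry]
    · obtain ⟨g, hg⟩ := not_forall_not.1 hf
      by_cases hrob : s.robot = r
      · subst hrob
        refine ⟨_, .pick s x g hr hg, fun _ => ⟨g, by simp⟩, ?_⟩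
        simp only [gripV, hr, if_neg hf]
        simp [hry]
      · have : (!s.robot) = r := by revert hrob; cases s.robot <;> cases r <;> simp
        refine ⟨_, .move s, by simp [hr], ?_⟩
        simp only [gripV, hr, if_neg hf, this]
        simp [hry, hrob]

theorem gripV_upper {Ball : Type*} [DecidableEq Ball] {x : Ball} {y : Bool} (n : ℕ) :
    ∀ (s : GripState Ball), gripInv x s → (s.ballAt x = none → ∃ g, s.grip g = some x) →
    gripV x y s = n → n ∈ GripPlanLengths s (fun t => t.ballAt x = some y) := by
  induction n with
  | zero =>
    intro s _ _ h
    apply grip_zero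
    by_contra hc
    unfold gripV at h
    rw [if_neg hc] at h
    split_ifs at h <;> omega
  | succ n ih =>
    intro s hs hw h
    obtain ⟨t, hst, hw', ht⟩ := grip_progress (y := y) hw hs (by omega)
    exact grip_cons hst (ih t (gripInv_step hst hs) hw' (by omega))

/-- **Optimal value function for single-ball Gripper**: for the goal `At(x,y)`
(ball `x` in room `y`) and every well-formed state `s`:
`V*(s) = 0` if `x` is in room `y`;
`V*(s) = 1 + [robot not in room y]` if `x` is held; and
`V*(s) = 3 + [robot not in room r] + [both grippers occupied]` if `x` is in a
room `r ≠ y`. -/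
theorem gripper_optimal_value {Ball : Type*} [DecidableEq Ball]
    (x : Ball) (y : Bool) (s : GripState Ball) (hwf : WFGrip s) :
    IsLeast (GripPlanLengths s (fun t => t.ballAt x = some y))
      (if s.ballAt x = some y then 0
       else if s.ballAt x = none then
         1 + (if s.robot ≠ y then 1 else 0)
       else
         3 + (if some s.robot ≠ s.ballAt x then 1 else 0) +
           (if ∀ g, s.grip g ≠ none then 1 else 0)) := by
  have hs : gripInv x s := ⟨fun g hg => (hwf.1 x).2 ⟨g, hg⟩, fun g g' => hwf.2 g g' x⟩
  have hu := gripV_upper (y := y) _ s hs (hwf.1 x).1 rfl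
  have hl : gripV x y s ∈ lowerBounds (GripPlanLengths s (fun t => t.ballAt x = some y)) :=
    fun n hn => gripV_lower n s hs hn
  have : IsLeast (GripPlanLengths s (fun t => t.ballAt x = some y)) (gripV x y s) := ⟨hu, hl⟩
  unfold gripV at this
  convert this
end

section
/- In the Visitall domain with a single target vertex t, the optimal value function equals graph distance: for every state s, if t is already visited then V*(s) = 0, and otherwise, if t is reachable from the robot's current vertex v, then V*(s) equals the shortest-path distance from v to t in the graph. -/
/-- A Visitall state: a robot located at a cell, together with the set of
visited cells (which is required to contain the robot's cell). -/
structure VisitState (C : Type*) where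
  pos : C
  visited : Set C

/-- The only Visitall action: move the robot along an edge of the graph to an
adjacent cell, which then becomes visited. -/
inductive VisitStep {C : Type*} (G : SimpleGraph C) :
    VisitState C → VisitState C → Prop
  | move (s : VisitState C) (c : C) (h : G.Adj s.pos c) :
      VisitStep G s ⟨c, insert c s.visited⟩

/-- The set of lengths of plans from state `s` to the goal `Visited(t)`;
the optimal value `V*(s)` is its least element. -/
def VisitPlanLengths {C : Type*} (G : SimpleGraph C) (s : VisitState C)
    (t : C) : Set ℕ :=
  {n | ∃ τ : ℕ → VisitState C,
    τ 0 = s ∧ (∀ i < n, VisitStep G (τ i) (τ (i + 1))) ∧ t ∈ (τ n).visited}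

theorem visit_lower {C : Type*} (G : SimpleGraph C) (t : C) (n : ℕ) :
    ∀ s : VisitState C, n ∈ VisitPlanLengths G s t →
      t ∈ s.visited ∨ ∃ p : G.Walk s.pos t, p.length ≤ n := by
  induction n with
  | zero =>
    rintro s ⟨τ, h0, _, h⟩
    left
    rwa [h0] at h
  | succ n ih =>
    rintro s ⟨τ, h0, hs, h⟩
    have h1 := ih (τ 1) ⟨fun i => τ (i + 1), rfl, fun i hi => hs (i + 1) (by omega), h⟩
    have h2 := hs 0 (by omega)
    rw [h0, zero_add] at h2
    generalize τ 1 = s' at h1 h2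
    cases h2 with
    | move c hadj =>
      rcases h1 with h1 | ⟨p, hp⟩
      · rcases h1 with rfl | h1
        · exact Or.inr ⟨SimpleGraph.Walk.cons hadj SimpleGraph.Walk.nil, by simp⟩
        · exact Or.inl h1
      · exact Or.inr ⟨SimpleGraph.Walk.cons hadj p, by simpa using hp⟩

theorem visit_upper {C : Type*} (G : SimpleGraph C) {u t : C} (p : G.Walk u t) :
    ∀ A : Set C, u ∈ A → p.length ∈ VisitPlanLengths G ⟨u, A⟩ t := by
  induction p with
  | nil => exact fun A hA => ⟨fun _ => ⟨_, A⟩, rfl, by simp, hA⟩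
  | @cons u v w hadj p ih =>
    intro A hA
    obtain ⟨τ, h0, hs, h⟩ := ih (insert v A) (Set.mem_insert _ _)
    refine ⟨fun i => Nat.casesOn (motive := fun _ => VisitState C) i ⟨u, A⟩ τ, rfl, ?_, h⟩
    intro i hi
    cases i with
    | zero =>
      change VisitStep G ⟨u, A⟩ (τ 0)
      rw [h0]
      exact VisitStep.move ⟨u, A⟩ v hadj
    | succ i => exact hs i (by simpa using hi)

/-- **Optimal value function for single-target Visitall equals graph
distance**: for every state `s`, if the target `t` is already visited then
`V*(s) = 0`, and otherwise, if `t` is reachable from the robot's current cell,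
then `V*(s)` is the shortest-path distance from the robot's cell to `t`. -/
theorem visitall_optimal_value {C : Type*} [Fintype C] (G : SimpleGraph C)
    (t : C) (s : VisitState C) (hinv : s.pos ∈ s.visited) :
    (t ∈ s.visited → IsLeast (VisitPlanLengths G s t) 0) ∧
    (t ∉ s.visited → G.Reachable s.pos t →
      IsLeast (VisitPlanLengths G s t) (G.dist s.pos t)) := by
  refine ⟨fun h => ⟨⟨fun _ => s, rfl, by simp, h⟩, fun _ _ => Nat.zero_le _⟩, fun hn hr => ⟨?_, ?_⟩⟩
  · obtain ⟨p, hp⟩ := hr.exists_walk_length_eq_dist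
    rw [← hp]
    exact visit_upper G p s.visited hinv
  · intro n h
    rcases visit_lower G t n s h with h | ⟨p, hp⟩
    · exact absurd h hn
    · exact (SimpleGraph.dist_le p).trans hp
end

section
/- In the Vacuum-M domain (robot vacuums sharing a common traversal map) with a single dirty target location ℓ, the optimal value function satisfies: for every state s in which ℓ is dirty and at least one robot can reach ℓ, V*(s) = 1 + min over all robots r of the shortest-path distance in the shared adjacency graph from the location of r to ℓ; and V*(s) = 0 if ℓ is clean. -/
/-- A Vacuum-M state: a finite set of robots, each located at a vertex of a
shared directed traversal map, together with the set of dirty locations. -/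
structure VacState (L R : Type*) where
  pos : R → L
  dirty : Set L

/-- The Vacuum-M actions: move one robot along an edge of the shared adjacency
graph, or have a robot located at a dirty location clean that location. -/
inductive VacStep {L R : Type*} [DecidableEq R] (Adj : L → L → Prop) :
    VacState L R → VacState L R → Prop
  | move (s : VacState L R) (r : R) (l' : L) (h : Adj (s.pos r) l') :
      VacStep Adj s ⟨Function.update s.pos r l', s.dirty⟩
  | clean (s : VacState L R) (r : R) (h : s.pos r ∈ s.dirty) :
      VacStep Adj s ⟨s.pos, s.dirty \ {s.pos r}⟩

/-- The set of lengths of plans from state `s` to the goal "the target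
location `ℓ` is clean"; the optimal value `V*(s)` is its least element. -/
def VacPlanLengths {L R : Type*} [DecidableEq R] (Adj : L → L → Prop)
    (s : VacState L R) (ℓ : L) : Set ℕ :=
  {n | ∃ τ : ℕ → VacState L R,
    τ 0 = s ∧ (∀ i < n, VacStep Adj (τ i) (τ (i + 1))) ∧ ℓ ∉ (τ n).dirty}

theorem vac_lower {L R : Type*} [DecidableEq R] (Adj : L → L → Prop) (ℓ : L) (n : ℕ) :
    ∀ s : VacState L R, ℓ ∈ s.dirty → n ∈ VacPlanLengths Adj s ℓ →
      ∃ m < n, ∃ r : R, ∃ z : ℕ → L,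
          z 0 = s.pos r ∧ (∀ i < m, Adj (z i) (z (i + 1))) ∧ z m = ℓ := by
  induction n with
  | zero =>
    rintro s hs ⟨τ, h0, -, h⟩
    rw [h0] at h
    exact absurd hs h
  | succ n ih =>
    rintro s hs ⟨τ, h0, hstep, hg⟩
    have h1 : VacStep Adj s (τ 1) := by
      have := hstep 0 (Nat.succ_pos n)
      rwa [h0] at this
    have hp : n ∈ VacPlanLengths Adj (τ 1) ℓ :=
      ⟨fun i => τ (i + 1), rfl, fun i hi => hstep (i + 1) (by omega), hg⟩
    generalize τ 1 = t at h1 hp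
    cases h1 with
    | move r l' h =>
      obtain ⟨m, hm, r', z, hz0, hz, hzm⟩ := ih ⟨Function.update s.pos r l', s.dirty⟩ hs hp
      by_cases hr : r' = r
      · subst hr
        simp only [Function.update_self] at hz0
        refine ⟨m + 1, by omega, r', fun i => Nat.casesOn i (s.pos r') z, rfl, ?_, hzm⟩
        intro i hi
        cases i with
        | zero => simpa [hz0] using h
        | succ i => exact hz i (by omega)
      · simp only [Function.update_of_ne hr] at hz0
        exact ⟨m, by omega, r', z, hz0, hz, hzm⟩
    | clean r h =>
      by_cases hr : s.pos r = ℓ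
      · exact ⟨0, by omega, r, fun _ => ℓ, hr.symm, fun i hi => by omega, rfl⟩
      · obtain ⟨m, hm, r', z, hz⟩ := ih ⟨s.pos, s.dirty \ {s.pos r}⟩ ⟨hs, fun e => hr e.symm⟩ hp
        exact ⟨m, by omega, r', z, hz⟩

/-- **Optimal value function for Vacuum-M** (robots sharing a common traversal
map, single dirty target `ℓ`): if `ℓ` is clean then `V*(s) = 0`; and if `ℓ` is
dirty and some robot can reach `ℓ`, then `V*(s) = 1 + d`, where `d` is the
minimum over all robots `r` of the shortest-path distance in the shared
adjacency graph from the location of `r` to `ℓ`. -/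
theorem vacuum_m_optimal_value {L R : Type*} [DecidableEq R]
    (Adj : L → L → Prop) (ℓ : L) (s : VacState L R) :
    (ℓ ∉ s.dirty → IsLeast (VacPlanLengths Adj s ℓ) 0) ∧
    (ℓ ∈ s.dirty → ∀ d : ℕ,
      IsLeast {n : ℕ | ∃ r : R, ∃ z : ℕ → L,
          z 0 = s.pos r ∧ (∀ i < n, Adj (z i) (z (i + 1))) ∧ z n = ℓ} d →
      IsLeast (VacPlanLengths Adj s ℓ) (d + 1)) := by
  refine ⟨fun h => ⟨⟨fun _ => s, rfl, fun i hi => by omega, h⟩, fun _ _ => Nat.zero_le _⟩, ?_⟩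
  rintro hs d ⟨⟨r, z, hz0, hz, hzd⟩, hmin⟩
  refine ⟨⟨fun i => if i ≤ d then ⟨Function.update s.pos r (z i), s.dirty⟩
    else ⟨Function.update s.pos r ℓ, s.dirty \ {ℓ}⟩, ?_, ?_, ?_⟩, ?_⟩
  · simp [hz0]
  · intro i hi
    by_cases hid : i < d
    · have h := VacStep.move (Adj := Adj) ⟨Function.update s.pos r (z i), s.dirty⟩ r (z (i + 1))
        (by simpa using hz i hid)
      have h2 : i ≤ d := hid.le
      have h3 : i + 1 ≤ d := hid
      simpa [h2, h3] using h
    · have e : i = d := by omega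
      subst e
      have h := VacStep.clean (Adj := Adj) ⟨Function.update s.pos r ℓ, s.dirty⟩ r
        (by simpa using hs)
      simpa [hzd] using h
  · simp
  · intro n hn
    obtain ⟨m, hm, hpath⟩ := vac_lower Adj ℓ n s hs hn
    have := hmin hpath
    omega
end
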